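/- arXiv:1106.5116 — 3 statements merged into one kernel-verified Lean document; each statement's English description precedes it below -/
import Mathlib

section
/- Assume ◊. Then there exists a Hausdorff topological space X that is dually second countable but is not a D-space. (This answers Problem 4.6 of van Mill, Tkachuk and Wilson in the negative.) -/
open Ordinal Set

/-- `ω₁` viewed as the set (type) of all countable ordinals. -/
abbrev Omega1 : Type 1 := {o : Ordinal // o < ω₁}

/-- `C ⊆ ω₁` is club: unbounded, and closed under limits of its elements. -/
def IsClubIn (C : Set Omega1) : Prop :=
  (∀ a : Omega1, ∃ c ∈ C, a < c) ∧
  ∀ a : Omega1, (∃ b, b < a) → (∀ b < a, ∃ c ∈ C, b < c ∧ c < a) → a ∈ C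

/-- `S ⊆ ω₁` is stationary: it meets every closed unbounded subset of `ω₁`. -/
def IsStationaryIn (S : Set Omega1) : Prop :=
  ∀ C : Set Omega1, IsClubIn C → (S ∩ C).Nonempty

/-- The diamond principle `◊`: there is a sequence `⟨A α : α < ω₁⟩` with `A α ⊆ α`
such that for every `B ⊆ ω₁` the set `{α | B ∩ α = A α}` is stationary in `ω₁`. -/
def DiamondPrinciple : Prop :=
  ∃ A : Omega1 → Set Omega1,
    (∀ α : Omega1, A α ⊆ {β | β < α}) ∧
    ∀ B : Set Omega1, IsStationaryIn {α | B ∩ {β | β < α} = A α}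

/-- A `T₁` space `X` is a `D`-space if for every open neighbourhood assignment
`x ↦ U x` there is a closed discrete `D ⊆ X` with `⋃ x ∈ D, U x = X`. -/
def IsDSpace (X : Type*) [TopologicalSpace X] : Prop :=
  ∀ U : X → Set X, (∀ x, IsOpen (U x) ∧ x ∈ U x) →
    ∃ D : Set X, IsClosed D ∧ DiscreteTopology D ∧ (⋃ x ∈ D, U x) = Set.univ

/-- `X` is dually second countable: for every open neighbourhood assignment `x ↦ U x`
there is a subspace `Y ⊆ X` which is second countable (in the subspace topology) and
whose assigned neighbourhoods cover `X`. -/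
def DuallySecondCountable (X : Type*) [TopologicalSpace X] : Prop :=
  ∀ U : X → Set X, (∀ x, IsOpen (U x) ∧ x ∈ U x) →
    ∃ Y : Set X, SecondCountableTopology Y ∧ (⋃ x ∈ Y, U x) = Set.univ

namespace DiamondSpace

open Cardinal

theorem exists_gt_of_countable {t : Set Omega1} (ht : t.Countable) : ∃ b, ∀ a ∈ t, a < b := by
  have : Nonempty Omega1 := ⟨⟨0, omega_pos 1⟩⟩
  obtain ⟨f, hf⟩ := countable_iff_exists_subset_range.1 ht
  have h : (⨆ n, ((f n).1 + 1)) < ω₁ :=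
    Ordinal.iSup_lt_omega_one fun n => (Cardinal.isSuccLimit_omega 1).add_one_lt (f n).2
  refine ⟨⟨_, h⟩, fun a ha => ?_⟩
  obtain ⟨n, rfl⟩ := hf ha
  exact (lt_add_one (f n).1).trans_le
    (Ordinal.le_iSup (fun n => (f n).1 + 1) n)

theorem exists_gt_omega1 (a : Omega1) : ∃ b, a < b := by
  simpa using exists_gt_of_countable (countable_singleton a)

theorem countable_Iio_omega1 (γ : Omega1) : (Iio γ).Countable := by
  have h : (Iio γ.1).Countable := by
    rw [← le_aleph0_iff_set_countable, Cardinal.mk_Iio_ordinal, lift_le_aleph0]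
    have h : ∀ o : Ordinal, o < ω₁ → o.card ≤ ℵ₀ := fun o ho => by
      rwa [← ord_aleph, lt_ord, lt_aleph_one_iff] at ho
    exact h _ γ.2
  exact (h.preimage Subtype.val_injective).mono fun x hx => hx

theorem countable_Iic_omega1 (γ : Omega1) : (Iic γ).Countable := by
  obtain ⟨b, hb⟩ := exists_gt_omega1 γ
  exact (countable_Iio_omega1 b).mono fun x hx => lt_of_le_of_lt hx hb

/-- The ordinals closed under `Φ` form a club. -/
theorem isClubIn_closed (Φ : Omega1 → Omega1) :
    IsClubIn {γ | (∃ b, b < γ) ∧ ∀ β < γ, Φ β < γ} := by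
  constructor
  · intro a
    have h : ∀ x : Omega1, ∃ y, x < y ∧ ∀ β ≤ x, Φ β < y := by
      intro x
      obtain ⟨y, hy⟩ := exists_gt_of_countable
        (((countable_Iic_omega1 x).image Φ).union (countable_singleton x))
      exact ⟨y, hy x (Or.inr rfl), fun β hβ => hy _ (Or.inl ⟨β, hβ, rfl⟩)⟩
    choose s hs hs' using h
    let u : ℕ → Omega1 := fun n => s^[n] a
    have hu : ∀ n, u (n + 1) = s (u n) := fun n => Function.iterate_succ_apply' s n a
    obtain ⟨b, hb⟩ := exists_gt_of_countable (countable_range u)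
    let S : Set Omega1 := {c | ∀ n, u n < c}
    have hS : S.Nonempty := ⟨b, fun n => hb _ ⟨n, rfl⟩⟩
    let γ := wellFounded_lt.min S hS
    have hγ : ∀ n, u n < γ := wellFounded_lt.min_mem S hS
    refine ⟨γ, ⟨⟨a, hγ 0⟩, fun β hβ => ?_⟩, hγ 0⟩
    have : β ∉ S := fun h => wellFounded_lt.not_lt_min S h hβ
    obtain ⟨n, hn⟩ : ∃ n, β ≤ u n := by simpa [S] using this
    exact (hs' _ _ hn).trans ((hu n) ▸ hγ (n + 1))
  · intro a ha h
    refine ⟨ha, fun β hβ => ?_⟩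
    obtain ⟨c, hc, hβc, hca⟩ := h β hβ
    exact (hc.2 β hβc).trans hca

/-- `◊` implies the continuum hypothesis. -/
theorem exists_injective_real (hd : DiamondPrinciple) : ∃ f : ℝ → Omega1, Function.Injective f := by
  obtain ⟨A, -, hA⟩ := hd
  have hω : ∀ n : ℕ, (n : Ordinal) < ω₁ := fun n =>
    (Ordinal.natCast_lt_omega0 n).trans omega0_lt_omega_one
  let i : ℕ → Omega1 := fun n => ⟨n, hω n⟩
  have hi : Function.Injective i := fun m n h =>
    Nat.cast_injective (R := Ordinal) (congrArg Subtype.val h)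
  obtain ⟨b, hb⟩ := exists_gt_of_countable (countable_range i)
  have key : ∀ s : Set ℕ, ∃ α, b < α ∧ i '' s = A α := by
    intro s
    obtain ⟨α, h1, h2, h3⟩ := hA (i '' s) _ (isClubIn_closed fun _ => b)
    obtain ⟨c, hc⟩ := h2
    refine ⟨α, h3 c hc, ?_⟩
    rw [← h1]
    refine (inter_eq_left.2 ?_).symm
    rintro _ ⟨n, -, rfl⟩
    exact (hb _ ⟨n, rfl⟩).trans (h3 c hc)
  choose f _ hf using key
  have hf' : Function.Injective f := fun s t h => hi.image_injective (by rw [hf, hf, h])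
  have : #ℝ ≤ #(Set ℕ) := by rw [mk_real, mk_set, mk_nat, two_power_aleph0]
  obtain ⟨g⟩ := this
  exact ⟨f ∘ g, hf'.comp g.injective⟩

/-- Points are indexed by a level and a real number. -/
abbrev Pt : Type 1 := Omega1 × ℝ

/-- Codes of basic open sets: a rational interval and a finite set of points. -/
abbrev Basic : Type 1 := (ℚ × ℚ) × Finset Pt

theorem exists_injective_basic (hd : DiamondPrinciple) :
    ∃ f : Basic → Omega1, Function.Injective f := by
  obtain ⟨f, hf⟩ := exists_injective_real hd
  have hinf : Infinite Omega1 := by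
    refine not_finite_iff_infinite.1 fun h => ?_
    obtain ⟨b, hb⟩ := exists_gt_of_countable (toFinite (univ : Set Omega1)).countable
    exact (hb b trivial).false
  have h0 : ℵ₀ ≤ #Omega1 := aleph0_le_mk _
  have hR : lift.{1} #ℝ ≤ #Omega1 := by
    have := mk_le_of_injective (f := f ∘ ULift.down.{1}) (hf.comp ULift.down_injective)
    simpa using this
  have hP : #Pt ≤ #Omega1 := by
    rw [mk_prod]
    simp only [Cardinal.lift_uzero]
    calc _ ≤ #Omega1 * #Omega1 := by gcongr
      _ = _ := mul_eq_self h0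
  have hF : #(Finset Pt) ≤ #Omega1 := by
    rw [mk_finset_of_infinite]; exact hP
  have : #Basic ≤ #Omega1 := by
    rw [mk_prod]
    calc _ ≤ #Omega1 * #Omega1 := by
          gcongr
          · simp
          · simpa using hF
      _ = _ := mul_eq_self h0
  obtain ⟨g⟩ := this
  exact ⟨g, g.injective⟩

/-- The points of `Act` at levels below `γ`. -/
def below (Act : Set Pt) (γ : Omega1) : Set Pt := {p | p ∈ Act ∧ p.1 < γ}

theorem below_mono (Act : Set Pt) {α β : Omega1} (h : α ≤ β) : below Act α ⊆ below Act β :=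
  fun _ hx => ⟨hx.1, hx.2.trans_le h⟩

theorem countable_finset_subset {s : Set Pt} (hs : s.Countable) :
    {F : Finset Pt | ↑F ⊆ s}.Countable := by
  refine ((countable_ofPred_finite_subset hs).preimage Finset.coe_injective).mono fun F hF => ?_
  exact ⟨F.finite_toSet, hF⟩

theorem countable_basic {s : Set Pt} (hs : s.Countable) :
    {q : Basic | ↑q.2 ⊆ s}.Countable :=
  ((countable_univ (α := ℚ × ℚ)).prod (countable_finset_subset hs)).mono
    fun _ hq => mem_prod.2 ⟨mem_univ _, hq⟩

theorem exists_rank : ∃ rk : Finset Pt → Omega1, ∀ F γ, (∃ b, b < γ) →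
    ((∀ x ∈ F, x.1 < γ) ↔ rk F < γ) := by
  let z : Omega1 := ⟨0, omega_pos 1⟩
  let _ : OrderBot Omega1 := { bot := z, bot_le := fun a => zero_le (a := a.1) }
  refine ⟨fun F => F.sup Prod.fst, fun F γ h => ?_⟩
  obtain ⟨b, hb⟩ := h
  exact (Finset.sup_lt_iff (bot_le.trans_lt hb)).symm

/-- Closure under an assignment `Ψ` on finitely supported objects follows from closure under a
suitable unary function. -/
theorem exists_closing {Q : Type*} {Act : Set Pt} (supp : Q → Finset Pt)
    (hc : ∀ b, {q | ↑(supp q) ⊆ below Act b}.Countable) (Ψ : Q → Omega1) :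
    ∃ Φ : Omega1 → Omega1, ∀ γ, (∃ b, b < γ) → (∀ β < γ, Φ β < γ) →
      ∀ q, ↑(supp q) ⊆ below Act γ → Ψ q < γ := by
  obtain ⟨rk, hrk⟩ := exists_rank
  have h : ∀ β, ∃ c, ∀ q, ↑(supp q) ⊆ Act → rk (supp q) = β → Ψ q < c := by
    intro β
    obtain ⟨b, hb⟩ := exists_gt_omega1 β
    obtain ⟨c, hc'⟩ := exists_gt_of_countable ((hc b).image Ψ)
    refine ⟨c, fun q hq hqβ => hc' _ ⟨q, fun x hx => ⟨hq hx, ?_⟩, rfl⟩⟩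
    exact (hrk _ b ⟨β, hb⟩).2 (hqβ ▸ hb) x hx
  choose Φ hΦ using h
  refine ⟨Φ, fun γ hγ hcl q hq => ?_⟩
  exact (hΦ _ q (fun x hx => (hq hx).1) rfl).trans
    (hcl _ ((hrk _ γ hγ).1 fun x hx => (hq hx).2))

/-- A form of `◊` guessing sets of codes of basic open sets. -/
theorem exists_guess (hd : DiamondPrinciple) : ∃ g : Omega1 → Set Basic,
    ∀ Act : Set Pt, (∀ b, (below Act b).Countable) → ∀ T : Set Basic, ∀ Φ : Omega1 → Omega1,
      ∃ γ, (∃ b, b < γ) ∧ (∀ β < γ, Φ β < γ) ∧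
        ∀ q : Basic, ↑q.2 ⊆ below Act γ → (q ∈ g γ ↔ q ∈ T) := by
  obtain ⟨e, he⟩ := exists_injective_basic hd
  obtain ⟨A, -, hA⟩ := hd
  refine ⟨fun γ => {q | e q ∈ A γ}, fun Act hAct T Φ => ?_⟩
  obtain ⟨Φ', hΦ'⟩ := exists_closing (Act := Act) (fun q : Basic => q.2)
    (fun b => countable_basic (hAct b)) e
  obtain ⟨γ, h1, h2, h3⟩ := hA (e '' T) _ (isClubIn_closed fun β => max (Φ β) (Φ' β))
  refine ⟨γ, h2, fun β hβ => (le_max_left _ _).trans_lt (h3 β hβ), fun q hq => ?_⟩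
  have hq' := hΦ' γ h2 (fun β hβ => (le_max_right _ _).trans_lt (h3 β hβ)) q hq
  change e q ∈ A γ ↔ _
  rw [← h1]
  simp [hq', he.mem_set_image]

/-- The data chosen at one level: the real numbers used there, and for each of them the set of
lower points whose distinguished neighbourhood contains the new point. -/
abbrev Stage : Type 1 := Set ℝ × (ℝ → Set Pt)

/-- The points of the space coded by `f`. -/
def act (f : Omega1 → Stage) : Set Pt := {p | p.2 ∈ (f p.1).1}

/-- `Nbr f y x` says that `y` lies in the distinguished neighbourhood of `x`. -/
def Nbr (f : Omega1 → Stage) (y x : Pt) : Prop := y.1 ≤ x.1 ∨ x ∈ (f y.1).2 y.2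

/-- The open rational interval coded by `s`. -/
def ival (s : ℚ × ℚ) : Set ℝ := Ioo (s.1 : ℝ) s.2

/-- The basic set coded by `q`. -/
def bas (f : Omega1 → Stage) (q : Basic) : Set Pt := {y | y.2 ∈ ival q.1 ∧ ∀ z ∈ q.2, Nbr f y z}

/-- `D` is closed and discrete in the space of points of levels below `γ`. -/
def LocDisc (f : Omega1 → Stage) (γ : Omega1) (D : Set Pt) : Prop :=
  ∀ x ∈ below (act f) γ, ∃ q : Basic, ↑q.2 ⊆ below (act f) γ ∧ x ∈ bas f q ∧
    ∀ y ∈ below (act f) γ, y ∈ D → y ∈ bas f q → y = x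

/-- The guessed family of codes over the points of levels below `γ`. -/
def fam (g : Omega1 → Set Basic) (f : Omega1 → Stage) (γ : Omega1) : Set Basic :=
  {q | ↑q.2 ⊆ below (act f) γ ∧ q ∈ g γ}

/-- The reals which a point whose lower trace avoids `D` may have while being covered by `G`. -/
def avoid (G : Set Basic) (D : Set Pt) : Set ℝ := {c | ∃ q ∈ G, c ∈ ival q.1 ∧ ∀ z ∈ q.2, z ∉ D}

/-- The family guessed at `γ` is to cover all points of level at least `γ`. -/
def Promised (g : Omega1 → Set Basic) (f : Omega1 → Stage) (γ : Omega1) : Prop :=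
  ∀ D, LocDisc f γ D → Dense (avoid (fam g f γ) D)

/-- `o` is an admissible choice at level `γ`. -/
def Valid (g : Omega1 → Set Basic) (f : Omega1 → Stage) (γ : Omega1) (o : Stage) : Prop :=
  o.1.Countable ∧ ∀ c ∈ o.1, (∀ x ∈ below (act f) γ, x.2 ≠ c) ∧
    ∀ β ≤ γ, Promised g f β → ∃ q ∈ fam g f β, c ∈ ival q.1 ∧ ↑q.2 ⊆ o.2 c

/-- The new points are dense and avoid the neighbourhoods of a set meeting all guessed sets. -/
def Escapes (g : Omega1 → Set Basic) (f : Omega1 → Stage) (γ : Omega1) (o : Stage) : Prop :=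
  ∃ D : Set Pt, (∀ q ∈ fam g f γ, q.1 = (0, 0) → ∃ z ∈ q.2, z ∈ D) ∧ Dense o.1 ∧ ∀ c, o.2 c = Dᶜ

/-- The finite set of new points is a limit of the guessed finite sets. -/
def Accumulates (g : Omega1 → Set Basic) (f : Omega1 → Stage) (γ : Omega1) (o : Stage) : Prop :=
  o.1.Finite ∧ ∀ W : Finset Basic, (∀ q ∈ W, ↑q.2 ⊆ below (act f) γ) →
    (∀ c ∈ o.1, ∃ q ∈ W, c ∈ ival q.1 ∧ ↑q.2 ⊆ o.2 c) →
    ∃ p ∈ fam g f γ, p.1 = (1, 1) ∧ ∀ x ∈ p.2, ∃ q ∈ W, x ∈ bas f q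

/-- The requirement on the choice `o` at level `γ`. -/
def Spec (g : Omega1 → Set Basic) (f : Omega1 → Stage) (γ : Omega1) (o : Stage) : Prop :=
  Valid g f γ o ∧
  ((∃ q ∈ fam g f γ, q.1 = (1, 1)) → (∃ o', Valid g f γ o' ∧ Accumulates g f γ o') →
    Accumulates g f γ o) ∧
  ((¬ ∃ q ∈ fam g f γ, q.1 = (1, 1)) → (∃ o', Valid g f γ o' ∧ Escapes g f γ o') →
    Escapes g f γ o)

theorem exists_spec (g : Omega1 → Set Basic) (f : Omega1 → Stage) (γ : Omega1) :
    ∃ o, Spec g f γ o := by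
  have h0 : Valid g f γ (∅, fun _ => ∅) := ⟨countable_empty, fun c hc => hc.elim⟩
  by_cases hB : ∃ q ∈ fam g f γ, q.1 = (1, 1)
  · by_cases h : ∃ o', Valid g f γ o' ∧ Accumulates g f γ o'
    · obtain ⟨o, ho, ho'⟩ := h
      exact ⟨o, ho, fun _ _ => ho', fun h => (h hB).elim⟩
    · exact ⟨_, h0, fun _ h' => (h h').elim, fun h => (h hB).elim⟩
  · by_cases h : ∃ o', Valid g f γ o' ∧ Escapes g f γ o'
    · obtain ⟨o, ho, ho'⟩ := h
      exact ⟨o, ho, fun h => (hB h).elim, fun _ _ => ho'⟩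
    · exact ⟨_, h0, fun h => (hB h).elim, fun _ h' => (h h').elim⟩

section Locality

variable {g : Omega1 → Set Basic} {f f' : Omega1 → Stage} {γ : Omega1}

theorem below_congr (h : ∀ β < γ, f β = f' β) : below (act f) γ = below (act f') γ := by
  ext p
  constructor <;> rintro ⟨h1, h2⟩ <;> refine ⟨?_, h2⟩ <;> simpa [act, h _ h2] using h1

theorem bas_congr (h : ∀ β < γ, f β = f' β) {x : Pt} (hx : x.1 < γ) (q : Basic) :
    x ∈ bas f q ↔ x ∈ bas f' q := by
  simp [bas, Nbr, h _ hx]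

theorem locDisc_congr (h : ∀ β < γ, f β = f' β) (D : Set Pt) :
    LocDisc f γ D ↔ LocDisc f' γ D := by
  unfold LocDisc
  rw [below_congr h]
  refine forall₂_congr fun x hx => exists_congr fun q => and_congr_right fun _ => ?_
  rw [bas_congr h hx.2]
  refine and_congr_right fun _ => forall₂_congr fun y hy => ?_
  rw [bas_congr h hy.2]

theorem fam_congr (h : ∀ β < γ, f β = f' β) : fam g f γ = fam g f' γ := by
  unfold fam
  rw [below_congr h]

theorem promised_congr (h : ∀ β < γ, f β = f' β) : Promised g f γ ↔ Promised g f' γ := by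
  unfold Promised
  rw [fam_congr h]
  exact forall_congr' fun D => by rw [locDisc_congr h]

theorem valid_congr (h : ∀ β < γ, f β = f' β) (o : Stage) :
    Valid g f γ o ↔ Valid g f' γ o := by
  unfold Valid
  rw [below_congr h]
  refine and_congr_right fun _ => forall₂_congr fun c _ => and_congr_right fun _ =>
    forall₂_congr fun β hβ => ?_
  have h' : ∀ δ < β, f δ = f' δ := fun δ hδ => h δ (hδ.trans_le hβ)
  rw [promised_congr h', fam_congr h']

theorem accumulates_congr (h : ∀ β < γ, f β = f' β) (o : Stage) :
    Accumulates g f γ o ↔ Accumulates g f' γ o := by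
  unfold Accumulates
  rw [below_congr h, fam_congr h]
  refine and_congr_right fun _ => forall₃_congr fun W _ _ => exists_congr fun p =>
    and_congr_right fun hp => and_congr_right fun _ => forall₂_congr fun x hx => ?_
  have hx' : x.1 < γ := (hp.1 hx).2
  simp only [bas_congr h hx']

theorem escapes_congr (h : ∀ β < γ, f β = f' β) (o : Stage) :
    Escapes g f γ o ↔ Escapes g f' γ o := by
  unfold Escapes
  rw [fam_congr h]

theorem spec_congr (h : ∀ β < γ, f β = f' β) (o : Stage) : Spec g f γ o ↔ Spec g f' γ o := by
  simp only [Spec, fam_congr h, valid_congr h, accumulates_congr h, escapes_congr h]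

end Locality

theorem exists_construction (g : Omega1 → Set Basic) :
    ∃ f : Omega1 → Stage, ∀ γ, Spec g f γ (f γ) := by
  classical
  choose next hnext using exists_spec g
  let ext : (γ : Omega1) → ((β : Omega1) → β < γ → Stage) → Omega1 → Stage :=
    fun γ h β => if hβ : β < γ then h β hβ else (∅, fun _ => ∅)
  let f : Omega1 → Stage := wellFounded_lt.fix fun γ h => next (ext γ h) γ
  refine ⟨f, fun γ => ?_⟩
  have hf : f γ = next (ext γ fun β _ => f β) γ := wellFounded_lt.fix_eq _ γ
  have := hnext (ext γ fun β _ => f β) γ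
  rw [← hf] at this
  refine (spec_congr (fun β hβ => ?_) _).1 this
  simp [ext, hβ]

theorem LocDisc.mono {f : Omega1 → Stage} {α γ : Omega1} (h : α ≤ γ) {D : Set Pt}
    (hD : LocDisc f γ D) : LocDisc f α D := by
  classical
  intro x hx
  obtain ⟨q, hq, hxq, hy⟩ := hD x (below_mono _ h hx)
  refine ⟨(q.1, q.2.filter fun z => z.1 < α), ?_, ?_, ?_⟩
  · intro z hz
    have hz' := Finset.mem_filter.1 hz
    exact ⟨(hq hz'.1).1, hz'.2⟩
  · exact ⟨hxq.1, fun z hz => hxq.2 z (Finset.mem_filter.1 hz).1⟩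
  · intro y hyα hyD hyb
    refine hy y (below_mono _ h hyα) hyD ⟨hyb.1, fun z hz => ?_⟩
    by_cases hzα : z.1 < α
    · exact hyb.2 z (Finset.mem_filter.2 ⟨hz, hzα⟩)
    · exact Or.inl (hyα.2.le.trans (not_lt.1 hzα))

theorem isOpen_avoid (G : Set Basic) (D : Set Pt) : IsOpen (avoid G D) := by
  refine isOpen_iff_forall_mem_open.2 fun c ⟨q, hq, hc, hz⟩ => ?_
  exact ⟨ival q.1, fun c' hc' => ⟨q, hq, hc', hz⟩, isOpen_Ioo, hc⟩

section Construction

variable {g : Omega1 → Set Basic} {f : Omega1 → Stage}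

theorem countable_below (hf : ∀ γ, Spec g f γ (f γ)) (b : Omega1) :
    (below (act f) b).Countable := by
  have h : (⋃ β ∈ Iio b, (Prod.mk β) '' (f β).1).Countable :=
    (countable_Iio_omega1 b).biUnion fun β _ => (hf β).1.1.image _
  refine h.mono fun p hp => ?_
  exact mem_biUnion hp.2 ⟨p.2, hp.1, rfl⟩

theorem snd_injOn_act (hf : ∀ γ, Spec g f γ (f γ)) {x y : Pt} (hx : x ∈ act f) (hy : y ∈ act f)
    (h : x.2 = y.2) : x = y := by
  rcases lt_trichotomy x.1 y.1 with h' | h' | h'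
  · exact (((hf y.1).1.2 _ hy).1 x ⟨hx, h'⟩ h).elim
  · exact Prod.ext h' h
  · exact (((hf x.1).1.2 _ hx).1 y ⟨hy, h'⟩ h.symm).elim

theorem exists_fam_of_promised (hf : ∀ γ, Spec g f γ (f γ)) {x : Pt} (hx : x ∈ act f)
    {β : Omega1} (hβ : β ≤ x.1) (hP : Promised g f β) :
    ∃ q ∈ fam g f β, x.2 ∈ ival q.1 ∧ ↑q.2 ⊆ (f x.1).2 x.2 :=
  ((hf x.1).1.2 _ hx).2 β hβ hP

theorem exists_escapes {γ : Omega1} (hc : (below (act f) γ).Countable) {D : Set Pt}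
    (hD : LocDisc f γ D) (hK : ∀ q ∈ fam g f γ, q.1 = (0, 0) → ∃ z ∈ q.2, z ∈ D) :
    ∃ o, Valid g f γ o ∧ Escapes g f γ o := by
  have h1 : Dense (⋂ x ∈ below (act f) γ, ({x.2}ᶜ : Set ℝ)) :=
    dense_biInter_of_isOpen (fun _ _ => isOpen_compl_singleton) hc
      fun _ _ => dense_compl_singleton _
  have hcP : {β | β ≤ γ ∧ Promised g f β}.Countable :=
    (countable_Iic_omega1 γ).mono fun β hβ => hβ.1
  have h2 : Dense (⋂ β ∈ {β | β ≤ γ ∧ Promised g f β}, avoid (fam g f β) D) :=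
    dense_biInter_of_isOpen (fun _ _ => isOpen_avoid _ _) hcP
      fun β hβ => hβ.2 D (hD.mono hβ.1)
  have h3 : Dense ((⋂ x ∈ below (act f) γ, ({x.2}ᶜ : Set ℝ)) ∩
      ⋂ β ∈ {β | β ≤ γ ∧ Promised g f β}, avoid (fam g f β) D) := by
    refine Dense.inter_of_Gδ ?_ ?_ h1 h2
    · exact IsGδ.biInter hc fun _ _ => isOpen_compl_singleton.isGδ
    · exact IsGδ.biInter hcP fun _ _ => (isOpen_avoid _ _).isGδ
  obtain ⟨t, ht, htc, htd⟩ := h3.exists_countable_dense_subset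
  refine ⟨(t, fun _ => Dᶜ), ⟨htc, fun c hct => ⟨fun x hx hxc => ?_, fun β hβ hP => ?_⟩⟩,
    D, hK, htd, fun _ => rfl⟩
  · exact mem_iInter₂.1 (ht hct).1 x hx hxc.symm
  · obtain ⟨q, hq, hcq, hz⟩ := mem_iInter₂.1 (ht hct).2 β ⟨hβ, hP⟩
    exact ⟨q, hq, hcq, fun z hzq => hz z hzq⟩

/-- The guessing property of the sequence `g`, relative to the points of `f`. -/
def Guesses (g : Omega1 → Set Basic) (f : Omega1 → Stage) : Prop :=
  ∀ T : Set Basic, ∀ Φ : Omega1 → Omega1, ∃ γ, (∃ b, b < γ) ∧ (∀ β < γ, Φ β < γ) ∧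
    fam g f γ = {q | ↑q.2 ⊆ below (act f) γ ∧ q ∈ T}

theorem exists_escaping_level (hf : ∀ γ, Spec g f γ (f γ)) (hg : Guesses g f)
    {𝒦 : Set (Finset Pt)} {δ : Omega1} (h𝒦 : ∀ K ∈ 𝒦, ↑K ⊆ below (act f) δ)
    (h : ∀ γ, ∃ D, LocDisc f γ D ∧ ∀ K ∈ 𝒦, ∃ z ∈ K, z ∈ D) :
    ∃ γ, δ ≤ γ ∧ ∃ D : Set Pt, (∀ K ∈ 𝒦, ∃ z ∈ K, z ∈ D) ∧ Dense (f γ).1 ∧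
      ∀ c, (f γ).2 c = Dᶜ := by
  obtain ⟨γ, ⟨b, hb⟩, hcl, hfam⟩ := hg {q | q.1 = (0, 0) ∧ q.2 ∈ 𝒦} fun _ => δ
  have hδ : δ < γ := hcl b hb
  have htag : ¬ ∃ q ∈ fam g f γ, q.1 = (1, 1) := by
    rintro ⟨q, hq, hq1⟩
    rw [hfam] at hq
    have := hq1.symm.trans hq.2.1
    simp at this
  obtain ⟨D, hD, hKD⟩ := h γ
  have hmem : ∀ q ∈ fam g f γ, q.1 = (0, 0) → ∃ z ∈ q.2, z ∈ D := by
    intro q hq _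
    rw [hfam] at hq
    exact hKD _ hq.2.2
  obtain ⟨D', hD', hdense, hS⟩ :=
    (hf γ).2.2 htag (exists_escapes (countable_below hf γ) hD hmem)
  refine ⟨γ, hδ.le, D', fun K hK => ?_, hdense, hS⟩
  refine hD' ((0, 0), K) ?_ rfl
  rw [hfam]
  exact ⟨(h𝒦 K hK).trans (below_mono _ hδ.le), rfl, hK⟩

theorem exists_valid_accumulates (hf : ∀ γ, Spec g f γ (f γ)) {γ : Omega1} {B : Set (Finset Pt)}
    (hfam : fam g f γ = {q | ↑q.2 ⊆ below (act f) γ ∧ q.1 = (1, 1) ∧ q.2 ∈ B})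
    (hrefl : ∀ W : Finset Basic, (∀ q ∈ W, ↑q.2 ⊆ below (act f) γ) →
      (∃ b ∈ B, ∀ x ∈ b, ∃ q ∈ W, x ∈ bas f q) →
      ∃ b ∈ B, ↑b ⊆ below (act f) γ ∧ ∀ x ∈ b, ∃ q ∈ W, x ∈ bas f q)
    {b : Finset Pt} (hb : b ∈ B) (hact : ↑b ⊆ act f) (hlev : ∀ x ∈ b, γ ≤ x.1) :
    ∃ o, Valid g f γ o ∧ Accumulates g f γ o := by
  refine ⟨(Prod.snd '' (b : Set Pt), fun c => {z | ∃ x ∈ b, x.2 = c ∧ z ∈ (f x.1).2 x.2}),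
    ⟨(b.finite_toSet.image _).countable, ?_⟩, b.finite_toSet.image _, ?_⟩
  · rintro _ ⟨x, hx, rfl⟩
    refine ⟨fun y hy hyx => ?_, fun β hβ hP => ?_⟩
    · have hxy := snd_injOn_act hf hy.1 (hact hx) hyx
      exact (hxy ▸ hy.2).not_ge (hlev x hx)
    · obtain ⟨q, hq, hxq, hqS⟩ :=
        exists_fam_of_promised hf (hact hx) (hβ.trans (hlev x hx)) hP
      exact ⟨q, hq, hxq, fun z hz => ⟨x, hx, rfl, hqS hz⟩⟩
  · intro W hW hcov
    obtain ⟨b', hb', hb'γ, hb'W⟩ := hrefl W hW ⟨b, hb, fun x hx => by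
      obtain ⟨q, hq, hxq, hqS⟩ := hcov x.2 ⟨x, hx, rfl⟩
      refine ⟨q, hq, hxq, fun z hz => Or.inr ?_⟩
      obtain ⟨x', hx', hxx', hz'⟩ := hqS hz
      rwa [snd_injOn_act hf (hact hx') (hact hx) hxx'] at hz'⟩
    refine ⟨((1, 1), b'), ?_, rfl, hb'W⟩
    rw [hfam]
    exact ⟨hb'γ, rfl, hb'⟩

theorem countable_finset_basic {s : Set Pt} (hs : s.Countable) [DecidableEq Pt] :
    {W : Finset Basic | ↑(W.biUnion Prod.snd) ⊆ s}.Countable := by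
  refine ((countable_ofPred_finite_subset (countable_basic hs)).preimage
    Finset.coe_injective).mono fun W hW => ?_
  refine ⟨W.finite_toSet, fun q hq z hz => hW ?_⟩
  exact Finset.mem_biUnion.2 ⟨q, hq, hz⟩

theorem exists_accumulating_level (hf : ∀ γ, Spec g f γ (f γ)) (hg : Guesses g f)
    {B : Set (Finset Pt)} (hB : ∀ b ∈ B, ↑b ⊆ act f)
    (hhigh : ∀ δ, ∃ b ∈ B, ∀ x ∈ b, δ ≤ x.1) :
    ∃ γ, ∀ α > γ, ∀ D, LocDisc f α D → ∃ b ∈ B, ↑b ⊆ below (act f) γ ∧ ∀ z ∈ b, z ∉ D := by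
  classical
  have hbd : ∀ b : Finset Pt, ∃ c, ∀ x ∈ b, x.1 < c := fun b => by
    obtain ⟨c, hc⟩ := exists_gt_of_countable (b.countable_toSet.image Prod.fst)
    exact ⟨c, fun x hx => hc _ ⟨x, hx, rfl⟩⟩
  have hΨ : ∀ W : Finset Basic, ∃ c, (∃ b ∈ B, ∀ x ∈ b, ∃ q ∈ W, x ∈ bas f q) →
      ∃ b ∈ B, (∀ x ∈ b, x.1 < c) ∧ ∀ x ∈ b, ∃ q ∈ W, x ∈ bas f q := by
    intro W
    by_cases h : ∃ b ∈ B, ∀ x ∈ b, ∃ q ∈ W, x ∈ bas f q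
    · obtain ⟨b, hb, hbW⟩ := h
      obtain ⟨c, hc⟩ := hbd b
      exact ⟨c, fun _ => ⟨b, hb, hc, hbW⟩⟩
    · exact ⟨⟨0, omega_pos 1⟩, fun h' => (h h').elim⟩
  choose Ψ hΨ using hΨ
  obtain ⟨Φ, hΦ⟩ := exists_closing (Act := act f) (fun W : Finset Basic => W.biUnion Prod.snd)
    (fun b => countable_finset_basic (countable_below hf b)) Ψ
  obtain ⟨b₀, hb₀, -⟩ := hhigh ⟨0, omega_pos 1⟩
  obtain ⟨c₀, hc₀⟩ := hbd b₀
  obtain ⟨γ, hγ, hcl, hfam⟩ := hg {q | q.1 = (1, 1) ∧ q.2 ∈ B} fun β => max (Φ β) c₀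
  have hc₀γ : c₀ < γ := (le_max_right _ _).trans_lt (hcl _ hγ.choose_spec)
  have hrefl : ∀ W : Finset Basic, (∀ q ∈ W, ↑q.2 ⊆ below (act f) γ) →
      (∃ b ∈ B, ∀ x ∈ b, ∃ q ∈ W, x ∈ bas f q) →
      ∃ b ∈ B, ↑b ⊆ below (act f) γ ∧ ∀ x ∈ b, ∃ q ∈ W, x ∈ bas f q := by
    intro W hW h
    obtain ⟨b, hb, hbΨ, hbW⟩ := hΨ W h
    refine ⟨b, hb, fun x hx => ⟨hB b hb hx, (hbΨ x hx).trans ?_⟩, hbW⟩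
    refine hΦ γ hγ (fun β hβ => (le_max_left _ _).trans_lt (hcl β hβ)) W fun z hz => ?_
    obtain ⟨q, hq, hzq⟩ := Finset.mem_biUnion.1 hz
    exact hW q hq hzq
  have htag : ∃ q ∈ fam g f γ, q.1 = (1, 1) := by
    refine ⟨((1, 1), b₀), ?_, rfl⟩
    rw [hfam]
    exact ⟨fun x hx => ⟨hB _ hb₀ hx, (hc₀ x hx).trans hc₀γ⟩, rfl, hb₀⟩
  obtain ⟨b, hb, hbγ⟩ := hhigh γ
  obtain ⟨hfin, hacc⟩ :=
    (hf γ).2.1 htag (exists_valid_accumulates hf hfam hrefl hb (hB b hb) hbγ)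
  refine ⟨γ, fun α hα D hD => ?_⟩
  have hq : ∀ c ∈ (f γ).1, ∃ q : Basic, ↑q.2 ⊆ below (act f) α ∧ (γ, c) ∈ bas f q ∧
      ∀ y ∈ below (act f) α, y ∈ D → y ∈ bas f q → y = (γ, c) :=
    fun c hc => hD (γ, c) ⟨hc, hα⟩
  choose! Q hQ1 hQ2 hQ3 using hq
  let R : ℝ → Basic := fun c => ((Q c).1, (Q c).2.filter fun z => z.1 < γ)
  obtain ⟨p, hp, -, hpW⟩ := hacc (hfin.toFinset.image R) (by
    intro q hq z hz
    obtain ⟨c, hc, rfl⟩ := Finset.mem_image.1 hq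
    have hz' := Finset.mem_filter.1 hz
    exact ⟨(hQ1 c (hfin.mem_toFinset.1 hc) hz'.1).1, hz'.2⟩) (by
    intro c hc
    refine ⟨R c, Finset.mem_image_of_mem _ (hfin.mem_toFinset.2 hc), (hQ2 c hc).1, ?_⟩
    intro z hz
    have hz' := Finset.mem_filter.1 hz
    exact ((hQ2 c hc).2 z hz'.1).resolve_left (not_le.2 hz'.2))
  have hp' := hp
  rw [hfam] at hp'
  refine ⟨p.2, hp'.2.2, hp'.1, fun x hx hxD => ?_⟩
  obtain ⟨q, hq, hxq⟩ := hpW x hx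
  obtain ⟨c, hc, rfl⟩ := Finset.mem_image.1 hq
  have hxγ := hp'.1 hx
  have : x = (γ, c) := by
    refine hQ3 c (hfin.mem_toFinset.1 hc) x (below_mono _ hα.le hxγ) hxD
      ⟨hxq.1, fun z hz => ?_⟩
    by_cases hzγ : z.1 < γ
    · exact hxq.2 z (Finset.mem_filter.2 ⟨hz, hzγ⟩)
    · exact Or.inl (hxγ.2.le.trans (not_lt.1 hzγ))
  rw [this] at hxγ
  exact hxγ.2.false

theorem exists_gt_of_finset (b : Finset Pt) : ∃ c, ∀ x ∈ b, x.1 < c := by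
  obtain ⟨c, hc⟩ := exists_gt_of_countable (b.countable_toSet.image Prod.fst)
  exact ⟨c, fun x hx => hc _ ⟨x, hx, rfl⟩⟩

theorem exists_ival_subset {c : ℝ} {U : Set ℝ} (hU : U ∈ nhds c) :
    ∃ s, c ∈ ival s ∧ ival s ⊆ U := by
  obtain ⟨l, u, ⟨hl, hu⟩, hs⟩ := mem_nhds_iff_exists_Ioo_subset.1 hU
  obtain ⟨p, hlp, hpc⟩ := exists_rat_btwn hl
  obtain ⟨r, hcr, hru⟩ := exists_rat_btwn hu
  exact ⟨(p, r), ⟨hpc, hcr⟩, (Ioo_subset_Ioo hlp.le hru.le).trans hs⟩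

/-- `D` is locally discrete below `α` and meets the supports of all codes in `T` whose interval
meets `ival s`. -/
def Hits (f : Omega1 → Stage) (T : Set Basic) (s : ℚ × ℚ) (α : Omega1) (D : Set Pt) : Prop :=
  LocDisc f α D ∧ ∀ q ∈ T, ↑q.2 ⊆ below (act f) α → (ival q.1 ∩ ival s).Nonempty →
    ∃ z ∈ q.2, z ∈ D

theorem exists_hits_of_not_covered (hf : ∀ γ, Spec g f γ (f γ)) (hg : Guesses g f) {T : Set Basic}
    (h : ∀ α, ∃ x ∈ act f, α ≤ x.1 ∧ ∀ q ∈ T, ↑q.2 ⊆ below (act f) α → x ∉ bas f q) :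
    ∃ s, (ival s).Nonempty ∧ ∀ α, ∃ D, Hits f T s α D := by
  have step : ∀ β, ∃ s, (ival s).Nonempty ∧ ∃ D, Hits f T s β D := by
    intro β
    obtain ⟨α, ⟨b, hb⟩, hcl, hfam⟩ := hg T fun _ => β
    have hβ : β < α := hcl b hb
    have hP : ¬ Promised g f α := fun hP => by
      obtain ⟨x, hx, hαx, hxq⟩ := h α
      obtain ⟨q, hq, hqi, hqx⟩ := exists_fam_of_promised hf hx hαx hP
      rw [hfam] at hq
      exact hxq q hq.2 hq.1 ⟨hqi, fun z hz => Or.inr (hqx hz)⟩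
    obtain ⟨D, hD, hdense⟩ : ∃ D, LocDisc f α D ∧ ¬ Dense (avoid (fam g f α) D) := by
      simpa [Promised] using hP
    obtain ⟨c, hc⟩ : ∃ c, c ∉ closure (avoid (fam g f α) D) := by
      simpa [Dense] using hdense
    obtain ⟨s, hcs, hs⟩ := exists_ival_subset (isClosed_closure.isOpen_compl.mem_nhds hc)
    refine ⟨s, ⟨c, hcs⟩, D, hD.mono hβ.le, fun q hq hqβ ⟨d, hdq, hds⟩ => ?_⟩
    by_contra! hqD
    refine hs hds (subset_closure ⟨q, ?_, hdq, hqD⟩)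
    rw [hfam]
    exact ⟨hqβ.trans (below_mono _ hβ.le), hq⟩
  by_contra! hno
  have hb : ∀ s, ∃ α, (ival s).Nonempty → ∀ D, ¬ Hits f T s α D := by
    intro s
    by_cases hs : (ival s).Nonempty
    · obtain ⟨α, hα⟩ := hno s hs
      exact ⟨α, fun _ => hα⟩
    · exact ⟨⟨0, omega_pos 1⟩, fun h => (hs h).elim⟩
  choose a ha using hb
  obtain ⟨β, hβ⟩ := exists_gt_of_countable (countable_range a)
  obtain ⟨s, hs, D, hD, hT⟩ := step β
  have hsβ : a s ≤ β := (hβ _ ⟨s, rfl⟩).le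
  exact ha s hs D ⟨hD.mono hsβ, fun q hq hqa => hT q hq (hqa.trans (below_mono _ hsβ))⟩

/-- `K` is an initial part of members of `𝓕` whose remaining points have arbitrarily high
levels. -/
def IsRoot (𝓕 : Set (Finset Pt)) (K : Finset Pt) : Prop :=
  ∀ δ, ∃ F ∈ 𝓕, K ⊆ F ∧ ∀ x ∈ F, x.1 < δ → x ∈ K

theorem exists_isRoot_filter (hf : ∀ γ, Spec g f γ (f γ)) (hg : Guesses g f)
    {𝓕 : Set (Finset Pt)} (h𝓕 : ∀ F ∈ 𝓕, ↑F ⊆ act f) :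
    ∃ δ, ∀ F ∈ 𝓕, IsRoot 𝓕 (F.filter fun x => x.1 < δ) := by
  classical
  have hε : ∀ K, ∃ ε, ¬ IsRoot 𝓕 K → ∀ F ∈ 𝓕, K ⊆ F → ∃ x ∈ F, x.1 < ε ∧ x ∉ K := by
    intro K
    by_cases hK : IsRoot 𝓕 K
    · exact ⟨⟨0, omega_pos 1⟩, fun h => (h hK).elim⟩
    · obtain ⟨ε, hε⟩ : ∃ δ, ∀ F ∈ 𝓕, K ⊆ F → ∃ x ∈ F, x.1 < δ ∧ x ∉ K := by
        simpa only [IsRoot, not_forall, not_exists, not_and, exists_prop] using hK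
      exact ⟨ε, fun _ => hε⟩
  choose ε hε using hε
  obtain ⟨Φ, hΦ⟩ := exists_closing (Act := act f) (fun K : Finset Pt => K)
    (fun b => countable_finset_subset (countable_below hf b)) ε
  obtain ⟨δ, hδ, hcl, -⟩ := hg ∅ Φ
  refine ⟨δ, fun F hF => ?_⟩
  by_contra hK
  obtain ⟨x, hxF, hxε, hxK⟩ := hε _ hK F hF (Finset.filter_subset _ _)
  have hlt : ε (F.filter fun x => x.1 < δ) < δ := hΦ δ hδ hcl _ fun z hz => by
    have hz' := Finset.mem_filter.1 (Finset.mem_coe.1 hz)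
    exact ⟨h𝓕 F hF hz'.1, hz'.2⟩
  exact hxK (Finset.mem_filter.2 ⟨hxF, hxε.trans hlt⟩)

theorem IsRoot.exists_mem_of_hits (hf : ∀ γ, Spec g f γ (f γ)) (hg : Guesses g f) {T : Set Basic}
    (hT : ∀ q ∈ T, ↑q.2 ⊆ act f) {s : ℚ × ℚ} {K : Finset Pt} (hKact : ↑K ⊆ act f)
    (hK : IsRoot {F | ∃ q ∈ T, q.2 = F ∧ (ival q.1 ∩ ival s).Nonempty} K) :
    ∃ γ, ∀ α ≥ γ, ∀ D, Hits f T s α D → ∃ z ∈ K, z ∈ D := by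
  classical
  obtain ⟨γ, hγ⟩ := exists_accumulating_level hf hg
    (B := {b | ∃ q ∈ T, K ⊆ q.2 ∧ (ival q.1 ∩ ival s).Nonempty ∧ b = q.2 \ K})
    (by
      rintro _ ⟨q, hq, -, -, rfl⟩ z hz
      exact hT q hq (Finset.mem_sdiff.1 (Finset.mem_coe.1 hz)).1)
    (by
      intro δ
      obtain ⟨_, ⟨q, hq, rfl, hs⟩, hKq, hx⟩ := hK δ
      refine ⟨_, ⟨q, hq, hKq, hs, rfl⟩, fun x hx' => ?_⟩
      have hx' := Finset.mem_sdiff.1 hx'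
      exact le_of_not_gt fun hlt => hx'.2 (hx x hx'.1 hlt))
  obtain ⟨b, hb⟩ := exists_gt_of_finset K
  obtain ⟨γ', hγ'⟩ := exists_gt_omega1 (max γ b)
  refine ⟨γ', fun α hα D hD => ?_⟩
  have hγα : γ < α := ((le_max_left _ _).trans_lt hγ').trans_le hα
  have hbα : b < α := ((le_max_right _ _).trans_lt hγ').trans_le hα
  obtain ⟨_, ⟨q, hq, hKq, hs, rfl⟩, hlow, hmiss⟩ := hγ α hγα D hD.1
  obtain ⟨z, hz, hzD⟩ := hD.2 q hq (fun z hz => by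
    by_cases hzK : z ∈ K
    · exact ⟨hKact hzK, (hb z hzK).trans hbα⟩
    · exact below_mono _ hγα.le (hlow (Finset.mem_coe.2 (Finset.mem_sdiff.2 ⟨hz, hzK⟩)))) hs
  refine ⟨z, by_contra fun hzK => hmiss z (Finset.mem_sdiff.2 ⟨hz, hzK⟩) hzD, hzD⟩

theorem exists_covering_level (hf : ∀ γ, Spec g f γ (f γ)) (hg : Guesses g f) {T : Set Basic}
    (hT : ∀ q ∈ T, ↑q.2 ⊆ act f) (hcov : ∀ x ∈ act f, ∃ q ∈ T, x ∈ bas f q) :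
    ∃ α, ∀ x ∈ act f, α ≤ x.1 → ∃ q ∈ T, ↑q.2 ⊆ below (act f) α ∧ x ∈ bas f q := by
  classical
  by_contra! hno
  obtain ⟨s, hs, hits⟩ := exists_hits_of_not_covered hf hg hno
  let 𝓕 : Set (Finset Pt) := {F | ∃ q ∈ T, q.2 = F ∧ (ival q.1 ∩ ival s).Nonempty}
  have h𝓕 : ∀ F ∈ 𝓕, ↑F ⊆ act f := by
    rintro _ ⟨q, hq, rfl, -⟩
    exact hT q hq
  obtain ⟨δ, hδ⟩ := exists_isRoot_filter hf hg h𝓕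
  let 𝒦 : Set (Finset Pt) := {K | ↑K ⊆ below (act f) δ ∧ IsRoot 𝓕 K}
  have h𝒦 : 𝒦.Countable :=
    (countable_finset_subset (countable_below hf δ)).mono fun K hK => hK.1
  have hroot : ∀ K : 𝒦, ∃ γ, ∀ α ≥ γ, ∀ D, Hits f T s α D → ∃ z ∈ K.1, z ∈ D :=
    fun K => K.2.2.exists_mem_of_hits hf hg hT fun z hz => (K.2.1 hz).1
  choose lev hlev using hroot
  have : Countable 𝒦 := h𝒦.to_subtype
  obtain ⟨γ', hγ'⟩ := exists_gt_of_countable (countable_range lev)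
  obtain ⟨γ, hδγ, D, hKD, hdense, htr⟩ := exists_escaping_level hf hg (𝒦 := 𝒦)
    (fun K hK => hK.1) fun γ => by
      obtain ⟨D, hD⟩ := hits (max γ γ')
      exact ⟨D, hD.1.mono (le_max_left _ _), fun K hK =>
        hlev ⟨K, hK⟩ _ ((hγ' _ ⟨⟨K, hK⟩, rfl⟩).le.trans (le_max_right _ _)) D hD⟩
  obtain ⟨c, hcs, hc⟩ := hdense.inter_open_nonempty _ isOpen_Ioo hs
  obtain ⟨q, hq, hqc, hqn⟩ := hcov (γ, c) hc
  have hqF : q.2 ∈ 𝓕 := ⟨q, hq, rfl, c, hqc, hcs⟩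
  obtain ⟨z, hz, hzD⟩ := hKD (q.2.filter fun x => x.1 < δ) ⟨fun z hz => by
    have hz' := Finset.mem_filter.1 (Finset.mem_coe.1 hz)
    exact ⟨h𝓕 _ hqF hz'.1, hz'.2⟩, hδ _ hqF⟩
  have hz' := Finset.mem_filter.1 hz
  rcases hqn z hz'.1 with h | h
  · exact (hδγ.trans h).not_gt hz'.2
  · change z ∈ (f γ).2 c at h
    rw [htr] at h
    exact h hzD

/-- The type of points of the space coded by `f`. -/
abbrev Space (f : Omega1 → Stage) : Type 1 := {p : Pt // p ∈ act f}

theorem exists_bas_inter (f : Omega1 → Stage) (q r : Basic) {x : Pt} (hq : x ∈ bas f q)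
    (hr : x ∈ bas f r) : ∃ p : Basic, (∀ z ∈ p.2, z ∈ q.2 ∨ z ∈ r.2) ∧ x ∈ bas f p ∧
      ∀ y ∈ bas f p, y ∈ bas f q ∧ y ∈ bas f r := by
  classical
  obtain ⟨s, hxs, hs⟩ := exists_ival_subset
    ((isOpen_Ioo.inter isOpen_Ioo : IsOpen (ival q.1 ∩ ival r.1)).mem_nhds ⟨hq.1, hr.1⟩)
  refine ⟨(s, q.2 ∪ r.2), fun z hz => Finset.mem_union.1 hz, ⟨hxs, fun z hz => ?_⟩,
    fun y hy => ⟨⟨(hs hy.1).1, fun z hz => hy.2 z (Finset.mem_union_left _ hz)⟩,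
      (hs hy.1).2, fun z hz => hy.2 z (Finset.mem_union_right _ hz)⟩⟩
  exact (Finset.mem_union.1 hz).elim (hq.2 z) (hr.2 z)

/-- The topology on the space coded by `f`, with the basic sets `bas f q` as a base. -/
instance instTopologicalSpaceSpace (f : Omega1 → Stage) : TopologicalSpace (Space f) where
  IsOpen O := ∀ x ∈ O, ∃ q : Basic, ↑q.2 ⊆ act f ∧ x.1 ∈ bas f q ∧
    ∀ y : Space f, y.1 ∈ bas f q → y ∈ O
  isOpen_univ x _ := by
    obtain ⟨s, hs, -⟩ := exists_ival_subset (Filter.univ_mem (f := nhds x.1.2))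
    exact ⟨(s, ∅), by simp, ⟨hs, by simp⟩, fun _ _ => trivial⟩
  isOpen_inter U V hU hV x hx := by
    obtain ⟨q, hq, hxq, hqU⟩ := hU x hx.1
    obtain ⟨r, hr, hxr, hrV⟩ := hV x hx.2
    obtain ⟨p, hp, hxp, hpq⟩ := exists_bas_inter f q r hxq hxr
    exact ⟨p, fun z hz => (hp z hz).elim (@hq z) (@hr z), hxp,
      fun y hy => ⟨hqU y (hpq _ hy).1, hrV y (hpq _ hy).2⟩⟩
  isOpen_sUnion 𝒰 h𝒰 := by
    rintro x ⟨U, hU, hxU⟩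
    obtain ⟨q, hq, hxq, hqU⟩ := h𝒰 U hU x hxU
    exact ⟨q, hq, hxq, fun y hy => ⟨U, hU, hqU y hy⟩⟩

theorem isOpen_iff {O : Set (Space f)} : IsOpen O ↔ ∀ x ∈ O, ∃ q : Basic, ↑q.2 ⊆ act f ∧
    x.1 ∈ bas f q ∧ ∀ y : Space f, y.1 ∈ bas f q → y ∈ O :=
  Iff.rfl

theorem isOpen_bas {q : Basic} (hq : ↑q.2 ⊆ act f) : IsOpen {x : Space f | x.1 ∈ bas f q} :=
  isOpen_iff.2 fun _ hx => ⟨q, hq, hx, fun _ hy => hy⟩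

theorem t2Space (hf : ∀ γ, Spec g f γ (f γ)) : T2Space (Space f) := by
  refine ⟨fun x y hxy => ?_⟩
  have hne : x.1.2 ≠ y.1.2 := fun h => hxy (Subtype.ext (snd_injOn_act hf x.2 y.2 h))
  obtain ⟨U, V, hU, hV, hxU, hyV, hUV⟩ := t2_separation hne
  obtain ⟨s, hxs, hs⟩ := exists_ival_subset (hU.mem_nhds hxU)
  obtain ⟨t, hyt, ht⟩ := exists_ival_subset (hV.mem_nhds hyV)
  refine ⟨_, _, isOpen_bas (q := (s, ∅)) (by simp), isOpen_bas (q := (t, ∅)) (by simp),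
    ⟨hxs, by simp⟩, ⟨hyt, by simp⟩, ?_⟩
  exact disjoint_left.2 fun z hz hz' => disjoint_left.1 hUV (hs hz.1) (ht hz'.1)

theorem secondCountableTopology_of_countable (hf : ∀ γ, Spec g f γ (f γ)) {Y : Set (Space f)}
    (hY : Y.Countable) : SecondCountableTopology Y := by
  classical
  obtain ⟨γ, hγ⟩ := exists_gt_of_countable (hY.image fun y => y.1.1)
  let 𝒬 : Set Basic := {q | ↑q.2 ⊆ below (act f) γ}
  have h𝒬 : 𝒬.Countable := countable_basic (countable_below hf γ)
  refine (TopologicalSpace.isTopologicalBasis_of_isOpen_of_nhds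
    (s := (fun q => {y : Y | y.1.1 ∈ bas f q}) '' 𝒬) ?_ ?_).secondCountableTopology (h𝒬.image _)
  · rintro _ ⟨q, hq, rfl⟩
    exact (isOpen_bas fun z hz => (hq hz).1).preimage continuous_subtype_val
  · intro y U hyU hU
    obtain ⟨O, hO, rfl⟩ := isOpen_induced_iff.1 hU
    obtain ⟨q, hq, hyq, hqO⟩ := isOpen_iff.1 hO y.1 hyU
    refine ⟨_, ⟨(q.1, q.2.filter fun z => z.1 < γ), fun z hz => ?_, rfl⟩, ?_, ?_⟩
    · have hz' := Finset.mem_filter.1 (Finset.mem_coe.1 hz)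
      exact ⟨hq hz'.1, hz'.2⟩
    · exact ⟨hyq.1, fun z hz => hyq.2 z (Finset.mem_filter.1 hz).1⟩
    · intro w hw
      refine hqO w.1 ⟨hw.1, fun z hz => ?_⟩
      by_cases hzγ : z.1 < γ
      · exact hw.2 z (Finset.mem_filter.2 ⟨hz, hzγ⟩)
      · exact Or.inl ((hγ _ ⟨w.1, w.2, rfl⟩).le.trans (le_of_not_gt hzγ))

theorem duallySecondCountable (hf : ∀ γ, Spec g f γ (f γ)) (hg : Guesses g f) :
    DuallySecondCountable (Space f) := by
  intro U hU
  have h : ∀ x : Space f, ∃ q : Basic, ↑q.2 ⊆ act f ∧ x.1 ∈ bas f q ∧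
      ∀ y : Space f, y.1 ∈ bas f q → y ∈ U x := fun x => isOpen_iff.1 (hU x).1 x (hU x).2
  choose q hq hxq hqU using h
  obtain ⟨α, hα⟩ := exists_covering_level hf hg (T := range q)
    (by rintro _ ⟨x, rfl⟩; exact hq x) fun x hx => ⟨_, ⟨⟨x, hx⟩, rfl⟩, hxq ⟨x, hx⟩⟩
  let R : Set Basic := {r | r ∈ range q ∧ ↑r.2 ⊆ below (act f) α}
  have hR : R.Countable := (countable_basic (countable_below hf α)).mono fun r hr => hr.2
  have : Countable R := hR.to_subtype
  choose w hw using fun r : R => r.2.1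
  let Y : Set (Space f) := {x | x.1 ∈ below (act f) α} ∪ range w
  have hY : Y.Countable :=
    ((countable_below hf α).preimage Subtype.val_injective).union (countable_range w)
  refine ⟨Y, secondCountableTopology_of_countable hf hY, eq_univ_of_forall fun x => ?_⟩
  by_cases hx : x.1.1 < α
  · exact mem_biUnion (Or.inl ⟨x.2, hx⟩ : x ∈ Y) (hU x).2
  · obtain ⟨r, hr, hrα, hxr⟩ := hα x.1 x.2 (le_of_not_gt hx)
    refine mem_biUnion (Or.inr ⟨⟨r, hr, hrα⟩, rfl⟩ : w ⟨r, hr, hrα⟩ ∈ Y) (hqU _ x ?_)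
    rwa [hw]

theorem locDisc_of_isClosed_of_discrete {D : Set (Space f)} (hD : IsClosed D)
    (hD' : DiscreteTopology D) (α : Omega1) : LocDisc f α (Subtype.val '' D) := by
  classical
  intro x hx
  obtain ⟨O, hO, hxO, hOD⟩ : ∃ O : Set (Space f), IsOpen O ∧ ⟨x, hx.1⟩ ∈ O ∧
      ∀ y ∈ D, y ∈ O → y.1 = x := by
    by_cases hxD : (⟨x, hx.1⟩ : Space f) ∈ D
    · obtain ⟨O, hO, h⟩ := isOpen_induced_iff.1 (isOpen_discrete ({⟨_, hxD⟩} : Set D))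
      refine ⟨O, hO, ?_, fun y hy hyO => ?_⟩
      · have : (⟨_, hxD⟩ : D) ∈ Subtype.val ⁻¹' O := h ▸ rfl
        exact this
      · have : (⟨y, hy⟩ : D) ∈ Subtype.val ⁻¹' O := hyO
        rw [h] at this
        exact congrArg (fun z : D => z.1.1) this
    · exact ⟨Dᶜ, hD.isOpen_compl, hxD, fun y hy hy' => (hy' hy).elim⟩
  obtain ⟨q, hq, hxq, hqO⟩ := isOpen_iff.1 hO _ hxO
  refine ⟨(q.1, q.2.filter fun z => z.1 < α), fun z hz => ?_,
    ⟨hxq.1, fun z hz => hxq.2 z (Finset.mem_filter.1 hz).1⟩, ?_⟩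
  · have hz' := Finset.mem_filter.1 (Finset.mem_coe.1 hz)
    exact ⟨hq hz'.1, hz'.2⟩
  · rintro _ hyα ⟨y, hyD, rfl⟩ hy
    refine hOD y hyD (hqO y ⟨hy.1, fun z hz => ?_⟩)
    by_cases hzα : z.1 < α
    · exact hy.2 z (Finset.mem_filter.2 ⟨hz, hzα⟩)
    · exact Or.inl (hyα.2.le.trans (le_of_not_gt hzα))

theorem not_isDSpace (hf : ∀ γ, Spec g f γ (f γ)) (hg : Guesses g f) : ¬ IsDSpace (Space f) := by
  intro hX
  obtain ⟨D, hcl, hdisc, hcov⟩ := hX (fun x => {y | Nbr f y.1 x.1}) fun x => by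
    refine ⟨isOpen_iff.2 fun y hy => ?_, Or.inl le_rfl⟩
    obtain ⟨s, hs, -⟩ := exists_ival_subset (Filter.univ_mem (f := nhds y.1.2))
    refine ⟨(s, {x.1}), by simp, ⟨hs, ?_⟩, fun z hz => hz.2 _ (by simp)⟩
    intro z hz
    rw [Finset.mem_singleton.1 hz]
    exact hy
  have hloc := locDisc_of_isClosed_of_discrete hcl hdisc
  by_cases hb : ∃ δ, ∀ d ∈ D, d.1.1 < δ
  · obtain ⟨δ, hδ⟩ := hb
    obtain ⟨γ, hδγ, E, hE, hdense, htr⟩ := exists_escaping_level hf hg (δ := δ)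
      (𝒦 := {K | ∃ d ∈ D, K = {d.1}})
      (by
        rintro _ ⟨d, hd, rfl⟩ z hz
        rw [Finset.mem_singleton.1 (Finset.mem_coe.1 hz)]
        exact ⟨d.2, hδ d hd⟩)
      fun γ => ⟨_, hloc γ, by
        rintro _ ⟨d, hd, rfl⟩
        exact ⟨d.1, Finset.mem_singleton_self _, d, hd, rfl⟩⟩
    obtain ⟨c, hc⟩ := hdense.nonempty
    have hy : (⟨(γ, c), hc⟩ : Space f) ∈ ⋃ x ∈ D, {y : Space f | Nbr f y.1 x.1} := hcov ▸ trivial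
    obtain ⟨d, hd, hyd⟩ := mem_iUnion₂.1 hy
    obtain ⟨z, hz, hzE⟩ := hE _ ⟨d, hd, rfl⟩
    rw [Finset.mem_singleton.1 hz] at hzE
    rcases hyd with h | h
    · exact (hδγ.trans h).not_gt (hδ d hd)
    · change d.1 ∈ (f γ).2 c at h
      rw [htr] at h
      exact h hzE
  · push Not at hb
    obtain ⟨γ, hγ⟩ := exists_accumulating_level hf hg (B := {b | ∃ d ∈ D, b = {d.1}})
      (by
        rintro _ ⟨d, -, rfl⟩ z hz
        rw [Finset.mem_singleton.1 (Finset.mem_coe.1 hz)]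
        exact d.2)
      fun δ => by
        obtain ⟨d, hd, hδd⟩ := hb δ
        refine ⟨_, ⟨d, hd, rfl⟩, fun x hx => ?_⟩
        rwa [Finset.mem_singleton.1 hx]
    obtain ⟨α, hα⟩ := exists_gt_omega1 γ
    obtain ⟨_, ⟨d, hd, rfl⟩, -, h⟩ := hγ α hα _ (hloc α)
    exact h _ (Finset.mem_singleton_self _) ⟨d, hd, rfl⟩

end Construction

end DiamondSpace

/-- Assuming `◊`, there is a Hausdorff space which is dually second countable
but not a `D`-space. -/
theorem statement7 (hd : DiamondPrinciple) :
    ∃ (X : Type 1) (τ : TopologicalSpace X),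
      @T2Space X τ ∧ @DuallySecondCountable X τ ∧ ¬ @IsDSpace X τ := by
  obtain ⟨g, hg⟩ := DiamondSpace.exists_guess hd
  obtain ⟨f, hf⟩ := DiamondSpace.exists_construction g
  have hG : DiamondSpace.Guesses g f := by
    intro T Φ
    obtain ⟨γ, hγ, hcl, h⟩ := hg _ (DiamondSpace.countable_below hf) T Φ
    exact ⟨γ, hγ, hcl, ext fun q => and_congr_right (h q)⟩
  exact ⟨DiamondSpace.Space f, inferInstance, DiamondSpace.t2Space hf,
    DiamondSpace.duallySecondCountable hf hG, DiamondSpace.not_isDSpace hf hG⟩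
end

section
/- Let X be a set carrying two topologies: a topology τ_sc that is Hausdorff and second countable, and a topology τ_hl that is hereditarily Lindelöf. Then the topology τ_ref generated by τ_sc ∪ τ_hl as a subbasis (the common refinement of the two topologies) is again Hausdorff and hereditarily Lindelöf. -/
open Set

/-- The infimum of a second countable topology and a hereditarily Lindelöf topology is
hereditarily Lindelöf. -/
theorem HereditarilyLindelofSpace.inf_of_secondCountable {X : Type*}
    {t₁ t₂ : TopologicalSpace X} (h₁ : @SecondCountableTopology X t₁)
    (h₂ : @HereditarilyLindelofSpace X t₂) :
    @HereditarilyLindelofSpace X (t₁ ⊓ t₂) := by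
  let b := @TopologicalSpace.countableBasis X t₁ h₁
  have hbc : b.Countable := @TopologicalSpace.countable_countableBasis X t₁ h₁
  have hb : @TopologicalSpace.IsTopologicalBasis X t₁ b :=
    @TopologicalSpace.isBasis_countableBasis X t₁ h₁
  refine @HereditarilyLindelofSpace.mk X (t₁ ⊓ t₂) fun s _ f hf _ hfs => ?_
  by_contra! hcl
  let piece (B : Set X) : Set X :=
    {x ∈ s | x ∈ B ∧ ∃ V ∈ @nhds X t₂ x, (B ∩ V)ᶜ ∈ f}
  have hpiece (B : Set X) : (piece B)ᶜ ∈ f := by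
    refine @IsLindelof.compl_mem_sets_of_nhdsWithin X t₂ (piece B)
      (@HereditarilyLindelofSpace.isLindelof X t₂ h₂ _) f _ ?_
    rintro x ⟨-, -, V, hV, hVf⟩
    refine ⟨piece B ∩ V, Filter.inter_mem (@self_mem_nhdsWithin X t₂ x (piece B))
      (@mem_nhdsWithin_of_mem_nhds X t₂ _ _ _ hV), Filter.mem_of_superset hVf ?_⟩
    exact compl_subset_compl.2 (inter_subset_inter_left _ fun y hy => hy.2.1)
  have hcover : s ⊆ ⋃ B ∈ b, piece B := by
    intro x hx
    have hdisj : Disjoint (@nhds X (t₁ ⊓ t₂) x) f :=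
      disjoint_iff.2 (Filter.not_neBot.1 (hcl x hx))
    obtain ⟨W, hW, T, hT, hWT⟩ := Filter.disjoint_iff.1 hdisj
    rw [@nhds_inf X t₁ t₂ x, Filter.mem_inf_iff_superset] at hW
    obtain ⟨U, hU, V, hV, hUV⟩ := hW
    obtain ⟨B, hB, hxB, hBU⟩ :=
      (@TopologicalSpace.IsTopologicalBasis.mem_nhds_iff X t₁ _ _ _ hb).1 hU
    refine mem_biUnion hB ⟨hx, hxB, V, hV, Filter.mem_of_superset hT ?_⟩
    exact fun y hy hyBV => disjoint_left.1 hWT (hUV ⟨hBU hyBV.1, hyBV.2⟩) hy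
  have hs : s ∈ f := Filter.le_principal_iff.1 hfs
  have hcompl : (⋃ B ∈ b, piece B)ᶜ ∈ f := by
    rw [compl_iUnion₂]
    exact (countable_bInter_mem hbc).2 fun B _ => hpiece B
  refine Filter.empty_notMem f (Filter.mem_of_superset (Filter.inter_mem hs hcompl) ?_)
  exact fun x hx => hx.2 (hcover hx.1)

/-- The common refinement of a Hausdorff second countable topology and a hereditarily
Lindelöf topology on the same set is again Hausdorff and hereditarily Lindelöf. -/
theorem statement9 {X : Type*} (tsc thl : TopologicalSpace X)
    (h2 : @T2Space X tsc) (hsc : @SecondCountableTopology X tsc)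
    (hhl : @HereditarilyLindelofSpace X thl) :
    @T2Space X (TopologicalSpace.generateFrom {s | tsc.IsOpen s ∨ thl.IsOpen s}) ∧
    @HereditarilyLindelofSpace X
      (TopologicalSpace.generateFrom {s | tsc.IsOpen s ∨ thl.IsOpen s}) := by
  have heq : TopologicalSpace.generateFrom {s | tsc.IsOpen s ∨ thl.IsOpen s} = tsc ⊓ thl := by
    conv_rhs => rw [← TopologicalSpace.generateFrom_setOfPred_isOpen tsc,
      ← TopologicalSpace.generateFrom_setOfPred_isOpen thl, ← generateFrom_union]
    rfl
  rw [heq]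
  exact ⟨t2Space_antitone inf_le_left h2,
    HereditarilyLindelofSpace.inf_of_secondCountable hsc hhl⟩
end

section
/- Let ω₁ denote the set of all countable ordinals and let U : ω₁ → 𝒫(ω₁) be an arbitrary assignment of subsets; for a finite F ⊆ ω₁ write U_F = ⋂{U_γ : γ ∈ F}. Let τ be the topology on ω₁ generated by {U_γ : γ < ω₁} as a subbasis. Suppose that for every uncountable family B of pairwise disjoint finite subsets of ω₁ there is a countable B' ⊆ B such that {U_F : F ∈ B'} is an ω-cover of a tail of ω₁, i.e. there is β < ω₁ such that every finite K ⊆ ω₁ \ (β+1) is contained in U_F for some F ∈ B'. Then every subspace of (ω₁, τ) is an (ε)-space. -/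
open Ordinal Set

/-- `X` is an `(ε)`-space: every ω-cover of `X` by open sets (a family such that every
finite subset of `X` is contained in one of its members) has a countable subfamily that
is still an ω-cover. -/
def IsEpsilonSpace (X : Type*) [TopologicalSpace X] : Prop :=
  ∀ 𝒰 : Set (Set X), (∀ U ∈ 𝒰, IsOpen U) → (∀ K : Finset X, ∃ U ∈ 𝒰, (K : Set X) ⊆ U) →
    ∃ 𝒱 ⊆ 𝒰, 𝒱.Countable ∧ ∀ K : Finset X, ∃ U ∈ 𝒱, (K : Set X) ⊆ U

theorem Omega1.countable_Iic (a : Omega1) : (Iic a).Countable := by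
  have hc : (Iic a.1).Countable := by
    rw [← Order.Iio_succ, ← Cardinal.le_aleph0_iff_set_countable, Cardinal.mk_Iio_ordinal,
      Cardinal.lift_le_aleph0, ← Order.lt_succ_iff, Cardinal.succ_aleph0, ← Cardinal.lt_ord,
      Cardinal.ord_aleph]
    exact (Cardinal.isSuccLimit_omega 1).succ_lt a.2
  exact (hc.preimage Subtype.val_injective).mono fun _ hx => hx

theorem Omega1.bddAbove_of_countable {s : Set Omega1} (hs : s.Countable) : BddAbove s := by
  have := hs.to_subtype
  refine ⟨⟨⨆ x : s, x.1.1, Ordinal.iSup_lt_omega_one fun x => x.1.2⟩, fun x hx => ?_⟩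
  exact Ordinal.le_iSup (fun x : s => x.1.1) ⟨x, hx⟩

theorem countable_setOf_finset_subset {α : Type*} {D : Set α} (hD : D.Countable) :
    {s : Finset α | (s : Set α) ⊆ D}.Countable := by
  refine ((Set.countable_ofPred_finite_subset hD).preimage Finset.coe_injective).mono ?_
  exact fun s hs => show (s : Set α).Finite ∧ _ from ⟨s.finite_toSet, hs⟩

theorem setOf_finset_subset_iUnion {α : Type*} {D : ℕ → Set α} (hD : Monotone D) :
    {s : Finset α | (s : Set α) ⊆ ⋃ n, D n} = ⋃ n, {s : Finset α | (s : Set α) ⊆ D n} := by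
  ext s
  simp only [mem_ofPred_eq, mem_iUnion]
  refine ⟨fun hs => ?_, fun ⟨n, hn⟩ => hn.trans (subset_iUnion D n)⟩
  exact hD.directed_le.exists_mem_subset_of_finset_subset_biUnion hs

theorem Omega1.exists_countable_closed (g : Finset Omega1 → Finset (Finset Omega1) → Omega1) :
    ∃ D : Set Omega1, D.Countable ∧ IsLowerSet D ∧
      ∀ a : Finset Omega1, (a : Set Omega1) ⊆ D → ∀ R : Finset (Finset Omega1),
        (R : Set (Finset Omega1)) ⊆ {s | (s : Set Omega1) ⊆ D} → g a R ∈ D := by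
  let T (D : Set Omega1) : Set (Finset Omega1 × Finset (Finset Omega1)) :=
    {a : Finset Omega1 | (a : Set Omega1) ⊆ D} ×ˢ
      {R : Finset (Finset Omega1) | (R : Set (Finset Omega1)) ⊆ {s | (s : Set Omega1) ⊆ D}}
  have hT (x : Omega1) : ∃ y, x ≤ y ∧ ∀ t ∈ T (Iic x), g t.1 t.2 ≤ y := by
    have hc := Omega1.countable_Iic x
    have hTc : (T (Iic x)).Countable := (countable_setOf_finset_subset hc).prod
      (countable_setOf_finset_subset (countable_setOf_finset_subset hc))
    obtain ⟨y, hy⟩ := Omega1.bddAbove_of_countable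
      ((hTc.image fun t => g t.1 t.2).insert x)
    exact ⟨y, hy (mem_insert _ _), fun t ht =>
      hy (mem_insert_of_mem _ (mem_image_of_mem (fun t => g t.1 t.2) ht))⟩
  choose f hf hgf using hT
  let x₀ : Omega1 := ⟨0, Ordinal.omega_pos 1⟩
  let δ (n : ℕ) : Omega1 := f^[n] x₀
  have hδ : Monotone fun n => Iic (δ n) := monotone_nat_of_le_succ fun n => by
    refine Iic_subset_Iic.2 ?_
    simp only [δ, Function.iterate_succ_apply']
    exact hf _
  refine ⟨⋃ n, Iic (δ n), countable_iUnion fun n => Omega1.countable_Iic _,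
    isLowerSet_iUnion fun n => isLowerSet_Iic _, fun a ha R hR => ?_⟩
  have hA : Monotone fun n => {s : Finset Omega1 | (s : Set Omega1) ⊆ Iic (δ n)} :=
    fun m n hmn s hs => Subset.trans hs (hδ hmn)
  rw [setOf_finset_subset_iUnion hδ] at hR
  have ha' : a ∈ ⋃ n, {s : Finset Omega1 | (s : Set Omega1) ⊆ Iic (δ n)} := by
    rw [← setOf_finset_subset_iUnion hδ]; exact ha
  have hR' := (setOf_finset_subset_iUnion hA).subset hR
  obtain ⟨m, hm⟩ := mem_iUnion.1 ha'
  obtain ⟨n, hn⟩ := mem_iUnion.1 hR'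
  refine mem_iUnion.2 ⟨max m n + 1, ?_⟩
  simp only [δ, Function.iterate_succ_apply', mem_Iic]
  refine hgf _ (a, R) ⟨hA (le_max_left m n) hm, ?_⟩
  exact Subset.trans hn (hA (le_max_right m n))

/-- Either countably many members of `P` index an ω-cover of a tail, or all members of `P`
meet a fixed countable ordinal. -/
theorem exists_countable_tail_cover_or_meets (U : Omega1 → Set Omega1)
    (h : ∀ B : Set (Finset Omega1), ¬ B.Countable → B.PairwiseDisjoint id →
      ∃ B' ⊆ B, B'.Countable ∧ ∃ β : Omega1,
        ∀ K : Finset Omega1, (∀ γ ∈ K, β < γ) →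
          ∃ F ∈ B', (K : Set Omega1) ⊆ ⋂ γ ∈ F, U γ)
    (P : Set (Finset Omega1)) :
    ∃ B' ⊆ P, B'.Countable ∧ ∃ β : Omega1,
      (∀ K : Finset Omega1, (∀ γ ∈ K, β < γ) → ∃ F ∈ B', (K : Set Omega1) ⊆ ⋂ γ ∈ F, U γ) ∨
      ∀ F ∈ P, ∃ γ ∈ F, γ ≤ β := by
  by_cases h0 : ∅ ∈ P
  · exact ⟨{∅}, by simpa using h0, countable_singleton _, ⟨0, Ordinal.omega_pos 1⟩,
      Or.inl fun K _ => ⟨∅, rfl, by simp⟩⟩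
  obtain ⟨B, hB⟩ := zorn_subset {B : Set (Finset Omega1) | B ⊆ P ∧ B.PairwiseDisjoint id}
    fun c hc hchain => ⟨⋃₀ c, ⟨sUnion_subset fun s hs => (hc hs).1,
      (pairwiseDisjoint_sUnion hchain.directedOn).2 fun s hs => (hc hs).2⟩,
      fun s hs => subset_sUnion_of_mem hs⟩
  obtain ⟨hBP, hBd⟩ := hB.prop
  by_cases hcount : B.Countable
  · obtain ⟨β, hβ⟩ := Omega1.bddAbove_of_countable
      (hcount.biUnion fun F _ => F.countable_toSet)
    refine ⟨∅, empty_subset _, countable_empty, β, Or.inr fun F hF => ?_⟩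
    by_contra! hlt
    have hdisj : ∀ G ∈ B, Disjoint F G := fun G hG => Finset.disjoint_left.2 fun γ hγF hγG =>
      (hlt γ hγF).not_ge (hβ (mem_biUnion hG hγG))
    have hFB : F ∈ B := hB.le_of_ge (y := insert F B)
      ⟨insert_subset hF hBP, hBd.insert fun G hG _ => hdisj G hG⟩ (subset_insert _ _)
      (mem_insert _ _)
    exact h0 (by rwa [← Finset.bot_eq_empty, ← disjoint_self.1 (hdisj F hFB)])
  · obtain ⟨B', hB', hc, β, hβ⟩ := h B hcount hBd
    exact ⟨B', hB'.trans hBP, hc, β, Or.inl hβ⟩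

theorem exists_finset_iInter_subset_of_isOpen {ι X : Type*} (U : ι → Set X) {s : Set X}
    (hs : (TopologicalSpace.generateFrom (range U)).IsOpen s) {x : X} (hx : x ∈ s) :
    ∃ F : Finset ι, x ∈ ⋂ γ ∈ F, U γ ∧ ⋂ γ ∈ F, U γ ⊆ s := by
  classical
  induction hs with
  | basic s hs =>
    obtain ⟨i, rfl⟩ := hs
    exact ⟨{i}, by simpa using hx, by simp⟩
  | univ => exact ⟨∅, by simp, by simp⟩
  | inter s t _ _ ihs iht =>
    obtain ⟨F, hF, hFs⟩ := ihs hx.1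
    obtain ⟨G, hG, hGt⟩ := iht hx.2
    have he : ⋂ γ ∈ F ∪ G, U γ = (⋂ γ ∈ F, U γ) ∩ ⋂ γ ∈ G, U γ :=
      Finset.iInf_union
    exact ⟨F ∪ G, he ▸ ⟨hF, hG⟩, he ▸ inter_subset_inter hFs hGt⟩
  | sUnion S _ ih =>
    obtain ⟨s, hs, hxs⟩ := hx
    obtain ⟨F, hF, hFs⟩ := ih s hs hxs
    exact ⟨F, hF, hFs.trans (subset_sUnion_of_mem hs)⟩

/-- If for every uncountable pairwise disjoint family `B` of finite subsets of `ω₁`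
there is a countable `B' ⊆ B` such that `{U_F : F ∈ B'}` (where `U_F = ⋂ γ ∈ F, U γ`)
is an ω-cover of a tail of `ω₁`, then every subspace of `ω₁` with the topology
generated by the `U γ` as a subbasis is an `(ε)`-space. -/
theorem statement10 (U : Omega1 → Set Omega1)
    (h : ∀ B : Set (Finset Omega1), ¬ B.Countable → B.PairwiseDisjoint id →
      ∃ B' ⊆ B, B'.Countable ∧ ∃ β : Omega1,
        ∀ K : Finset Omega1, (∀ γ ∈ K, β < γ) →
          ∃ F ∈ B', (K : Set Omega1) ⊆ ⋂ γ ∈ F, U γ) :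
    ∀ Y : Set Omega1,
      @IsEpsilonSpace Y (TopologicalSpace.induced (Subtype.val : Y → Omega1)
        (TopologicalSpace.generateFrom (Set.range U))) := by
  classical
  intro Y 𝒰 hopen hcov
  let Q (a : Finset Omega1) (R : Finset (Finset Omega1)) (F : Finset Omega1) (W : Set Y) : Prop :=
    W ∈ 𝒰 ∧ (∀ y : Y, y.1 ∈ a → y ∈ W) ∧
      ∀ r ∈ R, ∀ y : Y, y.1 ∈ ⋂ γ ∈ r, U γ → y.1 ∈ ⋂ γ ∈ F, U γ → y ∈ W
  choose B hBP hBc β hβ using fun a R =>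
    exists_countable_tail_cover_or_meets U h {F | ∃ W, Q a R F W}
  choose W hW using fun a R (F : B a R) => hBP a R F.2
  obtain ⟨D, hDc, hDl, hDβ⟩ := Omega1.exists_countable_closed β
  have hAc := countable_setOf_finset_subset hDc
  refine ⟨⋃ a ∈ {a : Finset Omega1 | (a : Set Omega1) ⊆ D},
    ⋃ R ∈ {R : Finset (Finset Omega1) | (R : Set (Finset Omega1)) ⊆ {s | (s : Set Omega1) ⊆ D}},
      range (W a R), ?_, ?_, fun K => ?_⟩
  · simp only [iUnion_subset_iff]
    rintro a - R - _ ⟨F, rfl⟩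
    exact (hW a R F).1
  · refine hAc.biUnion fun a _ => (countable_setOf_finset_subset hAc).biUnion fun R _ => ?_
    have := (hBc a R).to_subtype
    exact countable_range _
  obtain ⟨V, hV, hKV⟩ := hcov K
  obtain ⟨s, hs, rfl⟩ := hopen V hV
  have hF (x : Y) (hx : x ∈ K) := exists_finset_iInter_subset_of_isOpen U hs (hKV hx)
  choose! F hxF hFs using hF
  let a : Finset Omega1 := (K.image Subtype.val).filter (· ∈ D)
  let R : Finset (Finset Omega1) := K.image fun x => (F x).filter (· ∈ D)
  let F' : Finset Omega1 := (K.biUnion F).filter (· ∉ D)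
  have ha : (a : Set Omega1) ⊆ D := fun x hx => (Finset.mem_filter.1 hx).2
  have hR : (R : Set (Finset Omega1)) ⊆ {s | (s : Set Omega1) ⊆ D} := by
    intro r hr
    obtain ⟨x, -, rfl⟩ := Finset.mem_image.1 hr
    exact fun y hy => (Finset.mem_filter.1 hy).2
  have hQ : Q a R F' (Subtype.val ⁻¹' s) := by
    refine ⟨hV, fun y hy => ?_, fun r hr y hyr hyF => ?_⟩
    · obtain ⟨z, hz, hzy⟩ := Finset.mem_image.1 (Finset.mem_filter.1 hy).1
      exact Subtype.ext hzy ▸ hKV hz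
    · obtain ⟨x, hx, rfl⟩ := Finset.mem_image.1 hr
      refine hFs x hx (mem_iInter₂.2 fun γ hγ => ?_)
      by_cases hγD : γ ∈ D
      · exact mem_iInter₂.1 hyr γ (Finset.mem_filter.2 ⟨hγ, hγD⟩)
      · exact mem_iInter₂.1 hyF γ
          (Finset.mem_filter.2 ⟨Finset.mem_biUnion.2 ⟨x, hx, hγ⟩, hγD⟩)
  have hβD : β a R ∈ D := hDβ a ha R hR
  rcases hβ a R with htail | hmeet
  · obtain ⟨G, hG, hKG⟩ := htail ((K.image Subtype.val).filter (· ∉ D)) fun γ hγ =>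
      lt_of_not_ge fun hle => (Finset.mem_filter.1 hγ).2 (hDl hle hβD)
    refine ⟨W a R ⟨G, hG⟩, mem_biUnion ha (mem_biUnion hR (mem_range_self _)), fun x hx => ?_⟩
    obtain ⟨-, hWa, hWR⟩ := hW a R ⟨G, hG⟩
    have hxK : x.1 ∈ K.image Subtype.val := Finset.mem_image_of_mem _ hx
    by_cases hxD : x.1 ∈ D
    · exact hWa x (Finset.mem_filter.2 ⟨hxK, hxD⟩)
    · refine hWR _ (Finset.mem_image_of_mem _ hx) x (mem_iInter₂.2 fun γ hγ => ?_)
        (hKG (Finset.mem_filter.2 ⟨hxK, hxD⟩))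
      exact mem_iInter₂.1 (hxF x hx) γ (Finset.mem_filter.1 hγ).1
  · obtain ⟨γ, hγ, hle⟩ := hmeet F' ⟨_, hQ⟩
    exact absurd (hDl hle hβD) (Finset.mem_filter.1 hγ).2
end
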